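/- For the Lie algebra 𝔤₄,₈, the almost Norden structure (J₃,g) belongs to the class W₃: the cyclic sum F₃(x,y,z) + F₃(y,z,x) + F₃(z,x,y) vanishes for all x,y,z ∈ V and the Lee form θ₃ is identically zero; moreover F₃ ≠ 0 (for instance F₃(e₁,e₂,e₂) = 1), so the structure is not Kähler with respect to J₃. -/

import Mathlib

noncomputable section

/-- The underlying 4-dimensional real vector space. -/
abbrev V : Type := Fin 4 → ℝ

/-- The standard basis e₁,e₂,e₃,e₄ (indexed by 0,1,2,3). -/
def e (i : Fin 4) : V := Pi.single i 1

/-- The neutral metric g with g(e₁,e₁)=g(e₂,e₂)=1, g(e₃,e₃)=g(e₄,e₄)=−1. -/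
def gm (x y : V) : ℝ := x 0 * y 0 + x 1 * y 1 - x 2 * y 2 - x 3 * y 3

/-- The signs ε₁=ε₂=1, ε₃=ε₄=−1. -/
def eps : Fin 4 → ℝ := ![1, 1, -1, -1]

/-- J₁ : e₁↦e₂, e₂↦−e₁, e₃↦−e₄, e₄↦e₃. -/
def J1 (x : V) : V := ![-x 1, x 0, x 3, -x 2]

/-- J₂ : e₁↦e₃, e₂↦e₄, e₃↦−e₁, e₄↦−e₂. -/
def J2 (x : V) : V := ![-x 2, -x 3, x 0, x 1]

/-- J₃ : e₁↦−e₄, e₂↦e₃, e₃↦−e₂, e₄↦e₁. -/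
def J3 (x : V) : V := ![x 3, -x 2, x 1, -x 0]

/-- Lie bracket of 𝔤₄,₈ : [e₂,e₃]=e₁, [e₂,e₄]=e₂, [e₃,e₄]=−e₃. -/
def br (x y : V) : V :=
  ![x 1 * y 2 - x 2 * y 1, x 1 * y 3 - x 3 * y 1, -(x 2 * y 3 - x 3 * y 2), 0]

/-- Fundamental tensor F(x,y,z) = g((∇ₓ J)y, z) for an almost complex structure Jm. -/
def Fa (nab : V →ₗ[ℝ] V →ₗ[ℝ] V) (Jm : V → V) (x y z : V) : ℝ :=
  gm (nab x (Jm y) - Jm (nab x y)) z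

/-- Lee form θ(z) = Σᵢ εᵢ F(eᵢ,eᵢ,z). -/
def theta (nab : V →ₗ[ℝ] V →ₗ[ℝ] V) (Jm : V → V) : V → ℝ :=
  fun z => ∑ i, eps i * Fa nab Jm (e i) (e i) z

/-- Curvature operator R(x,y)z = ∇ₓ∇_y z − ∇_y∇ₓ z − ∇_{[x,y]} z. -/
def Rm (nab : V →ₗ[ℝ] V →ₗ[ℝ] V) (x y z : V) : V :=
  nab x (nab y z) - nab y (nab x z) - nab (br x y) z

/-- Curvature (0,4)-tensor R(x,y,z,w) = g(R(x,y)z, w). -/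
def R4 (nab : V →ₗ[ℝ] V →ₗ[ℝ] V) (x y z w : V) : ℝ := gm (Rm nab x y z) w

/-- Ricci tensor ρ(y,z) = Σᵢ εᵢ R(eᵢ,y,z,eᵢ). -/
def ricci (nab : V →ₗ[ℝ] V →ₗ[ℝ] V) (y z : V) : ℝ :=
  ∑ i, eps i * R4 nab (e i) y z (e i)

/-- Scalar curvature τ = Σⱼ εⱼ ρ(eⱼ,eⱼ). -/
def tau (nab : V →ₗ[ℝ] V →ₗ[ℝ] V) : ℝ := ∑ j, eps j * ricci nab (e j) (e j)

/-- Associated Ricci tensor ρ*(y,z) = Σᵢ εᵢ R(eᵢ,y,z,J eᵢ). -/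
def ricciS (nab : V →ₗ[ℝ] V →ₗ[ℝ] V) (Jm : V → V) (y z : V) : ℝ :=
  ∑ i, eps i * R4 nab (e i) y z (Jm (e i))

/-- ∗-scalar curvature τ* = Σⱼ εⱼ ρ*(eⱼ,eⱼ). -/
def tauS (nab : V →ₗ[ℝ] V →ₗ[ℝ] V) (Jm : V → V) : ℝ :=
  ∑ j, eps j * ricciS nab Jm (e j) (e j)

/-- ∗∗-scalar curvature τ** = Σⱼ εⱼ ρ*(eⱼ,J eⱼ). -/
def tauSS (nab : V →ₗ[ℝ] V →ₗ[ℝ] V) (Jm : V → V) : ℝ :=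
  ∑ j, eps j * ricciS nab Jm (e j) (Jm (e j))

/-- Basic sectional curvature k_{ij} = R(eᵢ,eⱼ,eⱼ,eᵢ)/(εᵢεⱼ). -/
def sek (nab : V →ₗ[ℝ] V →ₗ[ℝ] V) (i j : Fin 4) : ℝ :=
  R4 nab (e i) (e j) (e j) (e i) / (eps i * eps j)

/-- Antisymmetrized Kronecker symbol used to encode curvature-type tensors. -/
def D (a b i j : Fin 4) : ℝ :=
  (if i = a ∧ j = b then (1 : ℝ) else 0) - (if i = b ∧ j = a then (1 : ℝ) else 0)

/-- `J3` is self-adjoint with respect to the neutral metric. -/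
theorem gm_J3_left (a z : V) : gm (J3 a) z = gm a (J3 z) := by
  simp [gm, J3]
  ring

theorem gm_sub_left (a b z : V) : gm (a - b) z = gm a z - gm b z := by
  simp [gm]
  ring

/-- The fundamental tensor of `J3` expressed through the bracket by the Koszul formula. -/
theorem two_mul_Fa_J3 (nab : V →ₗ[ℝ] V →ₗ[ℝ] V)
    (hK : ∀ x y z : V, 2 * gm (nab x y) z = gm (br x y) z + gm (br z x) y + gm (br z y) x)
    (x y z : V) :
    2 * Fa nab J3 x y z =
      (gm (br x (J3 y)) z + gm (br z x) (J3 y) + gm (br z (J3 y)) x) -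
      (gm (br x y) (J3 z) + gm (br (J3 z) x) y + gm (br (J3 z) y) x) := by
  rw [Fa, gm_sub_left, gm_J3_left, mul_sub, hK, hK]

theorem stmt_14
    (nab : V →ₗ[ℝ] V →ₗ[ℝ] V)
    (hK : ∀ x y z : V, 2 * gm (nab x y) z = gm (br x y) z + gm (br z x) y + gm (br z y) x) :
    (∀ x y z : V, Fa nab J3 x y z + Fa nab J3 y z x + Fa nab J3 z x y = 0) ∧
    (∀ z : V, theta nab J3 z = 0) ∧
    Fa nab J3 (e 0) (e 1) (e 1) = 1 ∧
    (∃ x y z : V, Fa nab J3 x y z ≠ 0)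
  := by
    have hF := two_mul_Fa_J3 nab hK
    have h_ne : Fa nab J3 (e 0) (e 1) (e 1) = 1 := by
      have h := hF (e 0) (e 1) (e 1)
      simp [gm, br, J3, e] at h
      simp only [e]
      linarith
    refine ⟨fun x y z => ?_, fun z => ?_, h_ne, e 0, e 1, e 1, by simp [h_ne]⟩
    · have h₁ := hF x y z
      have h₂ := hF y z x
      have h₃ := hF z x y
      simp only [gm, br, J3, Matrix.cons_val] at h₁ h₂ h₃
      linarith
    · have h₀ := hF (e 0) (e 0) z
      have h₁ := hF (e 1) (e 1) z
      have h₂ := hF (e 2) (e 2) z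
      have h₃ := hF (e 3) (e 3) z
      simp [gm, br, J3, e] at h₀ h₁ h₂ h₃
      simp [theta, Fin.sum_univ_four, eps, e]
      linarith
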